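/- Let β > 0, let k = 1, and let f₋₊(x,y,z) = β(x²y²+y²z²+z²x²) − (x²+y²+z²−1/2)² + (1−k)/4 = β(x²y²+y²z²+z²x²) − (x²+y²+z²−1/2)². Then the set of singular points of the quartic Q⁻⁺(1) = {f₋₊ = 0}, that is, the set of points at which f₋₊ and all three of its partial derivatives vanish, is exactly the set of six points (±1/√2, 0, 0), (0, ±1/√2, 0), (0, 0, ±1/√2) (the vertices of an octahedron). -/

import Mathlib

/-- The quartic polynomial `β·v - (u - 1/2)² + (1-k)/4` defining `Q⁻⁺(k)`. -/
noncomputable def fMP (β k : ℝ) (p : EuclideanSpace ℝ (Fin 3)) : ℝ :=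
  β * ((p 0)^2*(p 1)^2 + (p 1)^2*(p 2)^2 + (p 2)^2*(p 0)^2)
    - ((p 0)^2 + (p 1)^2 + (p 2)^2 - 1/2)^2 + (1 - k)/4

/-- The differential of `fMP β k` in terms of its partial derivatives. -/
theorem hasFDerivAt_fMP (β k : ℝ) (p : EuclideanSpace ℝ (Fin 3)) :
    HasFDerivAt (fMP β k)
      ((2 * p 0 * (β * ((p 1)^2 + (p 2)^2) - 2 * ((p 0)^2 + (p 1)^2 + (p 2)^2 - 1/2))) •
          (EuclideanSpace.proj 0 : EuclideanSpace ℝ (Fin 3) →L[ℝ] ℝ) +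
        (2 * p 1 * (β * ((p 2)^2 + (p 0)^2) - 2 * ((p 0)^2 + (p 1)^2 + (p 2)^2 - 1/2))) •
          (EuclideanSpace.proj 1 : EuclideanSpace ℝ (Fin 3) →L[ℝ] ℝ) +
        (2 * p 2 * (β * ((p 0)^2 + (p 1)^2) - 2 * ((p 0)^2 + (p 1)^2 + (p 2)^2 - 1/2))) •
          (EuclideanSpace.proj 2 : EuclideanSpace ℝ (Fin 3) →L[ℝ] ℝ)) p := by
  have hc (i : Fin 3) : HasFDerivAt (fun q : EuclideanSpace ℝ (Fin 3) => q i)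
      ((EuclideanSpace.proj i : EuclideanSpace ℝ (Fin 3) →L[ℝ] ℝ)) p :=
    (EuclideanSpace.proj i : EuclideanSpace ℝ (Fin 3) →L[ℝ] ℝ).hasFDerivAt
  have hs (i : Fin 3) := (hc i).pow 2
  have h := ((((((hs 0).mul (hs 1)).add ((hs 1).mul (hs 2))).add
    ((hs 2).mul (hs 0))).const_mul β).sub
      (((((hs 0).add (hs 1)).add (hs 2)).sub_const (1/2)).pow 2)).add_const ((1 - k)/4)
  refine h.congr_fderiv ?_
  ext v
  simp
  ring

/-- for `β > 0` and `k = 1`, the singular points of `Q⁻⁺(1)` are the six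
points `(±1/√2,0,0), (0,±1/√2,0), (0,0,±1/√2)` (vertices of an octahedron). -/
theorem stmt_17 (β : ℝ) (hβ : 0 < β) :
    {p : EuclideanSpace ℝ (Fin 3) |
        fMP β 1 p = 0 ∧ fderiv ℝ (fMP β 1) p = 0} =
      {p : EuclideanSpace ℝ (Fin 3) | ∃ a : ℝ,
        (a = 1/Real.sqrt 2 ∨ a = -(1/Real.sqrt 2)) ∧
        ((p 0 = a ∧ p 1 = 0 ∧ p 2 = 0) ∨
         (p 0 = 0 ∧ p 1 = a ∧ p 2 = 0) ∨
         (p 0 = 0 ∧ p 1 = 0 ∧ p 2 = a))} := by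
  ext p
  simp only [Set.mem_ofPred_eq, (hasFDerivAt_fMP β 1 p).fderiv]
  constructor
  · rintro ⟨hf, hd⟩
    have euler := congrArg (fun L : EuclideanSpace ℝ (Fin 3) →L[ℝ] ℝ => L p) hd
    simp at euler
    unfold fMP at hf
    have hu : (p 0)^2 + (p 1)^2 + (p 2)^2 = 1/2 := by linarith
    have hv : (p 0)^2*(p 1)^2 + (p 1)^2*(p 2)^2 + (p 2)^2*(p 0)^2 = 0 := by
      rw [hu] at hf
      have : β * ((p 0)^2*(p 1)^2 + (p 1)^2*(p 2)^2 + (p 2)^2*(p 0)^2) = 0 := by linarith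
      exact (mul_eq_zero.mp this).resolve_left hβ.ne'
    have h01 : p 0 * p 1 = 0 := by
      nlinarith [sq_nonneg (p 0 * p 1), sq_nonneg (p 1 * p 2), sq_nonneg (p 2 * p 0)]
    have h12 : p 1 * p 2 = 0 := by
      nlinarith [sq_nonneg (p 0 * p 1), sq_nonneg (p 1 * p 2), sq_nonneg (p 2 * p 0)]
    have h20 : p 2 * p 0 = 0 := by
      nlinarith [sq_nonneg (p 0 * p 1), sq_nonneg (p 1 * p 2), sq_nonneg (p 2 * p 0)]
    have hroot (a : ℝ) (ha : a^2 = 1/2) : a = 1/Real.sqrt 2 ∨ a = -(1/Real.sqrt 2) := by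
      apply sq_eq_sq_iff_eq_or_eq_neg.mp
      rw [ha, div_pow, Real.sq_sqrt (by norm_num), one_pow]
    by_cases h0 : p 0 = 0
    · by_cases h1 : p 1 = 0
      · exact ⟨p 2, hroot _ (by simpa [h0, h1] using hu), by simp [h0, h1]⟩
      · have h2 : p 2 = 0 := (mul_eq_zero.mp h12).resolve_left h1
        exact ⟨p 1, hroot _ (by simpa [h0, h2] using hu), by simp [h0, h2]⟩
    · have h1 : p 1 = 0 := (mul_eq_zero.mp h01).resolve_left h0
      have h2 : p 2 = 0 := (mul_eq_zero.mp h20).resolve_right h0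
      exact ⟨p 0, hroot _ (by simpa [h1, h2] using hu), by simp [h1, h2]⟩
  · rintro ⟨a, ha, hp⟩
    have ha2 : a^2 = 1/2 := by
      rcases ha with rfl | rfl <;> simp
    rcases hp with ⟨h0, h1, h2⟩ | ⟨h0, h1, h2⟩ | ⟨h0, h1, h2⟩ <;>
      simp [fMP, h0, h1, h2, ha2]
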